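/- Let G be a finite connected simple graph on a nonempty vertex set with edge weights w : Sym2 V → ℝ satisfying w(e) ≥ 0 for every edge e, and let O be the set of vertices of G of odd degree. Then the infimum, over all closed walks p in G whose edge list contains every edge of G, of the walk weight of p equals Σ_{e ∈ E(G)} w(e) + min_{A} Σ_{{u,v} ∈ A} dist_w(u,v), where the minimum is over all perfect pairings A of O. Hence solving the Closed Undirected Chinese Postman Problem on G reduces to finding a minimum-weight perfect pairing of the odd-degree vertices with respect to shortest-path distances. -/

import Mathlib

/-- The walk weight of a walk: the sum, over the edge list of the walk
(edges counted with multiplicity), of the weights of those edges. -/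
def SimpleGraph.Walk.weight {V : Type*} {G : SimpleGraph V} (w : Sym2 V → ℝ)
    {u v : V} (p : G.Walk u v) : ℝ :=
  (p.edges.map w).sum

/-- The set of vertices of odd degree of a finite simple graph. -/
def SimpleGraph.oddDegreeVertices {V : Type*} [Fintype V] (G : SimpleGraph V)
    [DecidableRel G.Adj] : Finset V :=
  Finset.univ.filter fun v => Odd (G.degree v)

/-- A perfect pairing of a finite set `O`: a collection of unordered pairs of
distinct elements of `O` (2-element subsets of `O`) such that every element of
`O` lies in exactly one pair. -/
def IsPerfectPairingOn {V : Type*} (O : Finset V) (A : Finset (Sym2 V)) : Prop :=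
  (∀ e ∈ A, ¬ e.IsDiag ∧ ∀ v ∈ e, v ∈ O) ∧
    ∀ v ∈ O, ∃! e : Sym2 V, e ∈ A ∧ v ∈ e

/-- The shortest-path distance `dist_w` between the two endpoints of an
unordered pair `{u,v}`: the infimum of the walk weights over all walks in `G`
from `u` to `v`. -/
noncomputable def pairDist {V : Type*} (G : SimpleGraph V) (w : Sym2 V → ℝ)
    (e : Sym2 V) : ℝ :=
  sInf {r : ℝ | ∃ u v : V, e = s(u, v) ∧
    ∃ p : G.Walk u v, r = SimpleGraph.Walk.weight w p}

/-- The mod-2 boundary of an unordered pair: the indicator of its endpoints, with the two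
contributions of a diagonal pair cancelling. -/
def Sym2.boundary {V : Type*} [DecidableEq V] (e : Sym2 V) : V → ZMod 2 :=
  Sym2.lift ⟨fun a b => Pi.single a 1 + Pi.single b 1, fun _ _ => add_comm _ _⟩ e

/-- The mod-2 boundary of a multiset of unordered pairs, i.e. its degree function mod 2. -/
def Multiset.boundary {V : Type*} [DecidableEq V] (P : Multiset (Sym2 V)) : V → ZMod 2 :=
  (P.map Sym2.boundary).sum

section Boundary

variable {V : Type*} [DecidableEq V]

theorem Sym2.boundary_mk (a b : V) :
    s(a, b).boundary = Pi.single a 1 + Pi.single b 1 := rfl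

theorem Sym2.boundary_apply {e : Sym2 V} (he : ¬ e.IsDiag) (v : V) :
    e.boundary v = if v ∈ e then 1 else 0 := by
  induction e with
  | h a b =>
    rw [Sym2.mk_isDiag_iff] at he
    simp only [Sym2.boundary_mk, Pi.add_apply, Pi.single_apply, Sym2.mem_iff]
    by_cases h : v = a
    · simp [h, he]
    · simp [h]

theorem Sym2.boundary_of_isDiag {e : Sym2 V} (he : e.IsDiag) : e.boundary = 0 := by
  induction e with
  | h a b =>
    rw [Sym2.mk_isDiag_iff] at he
    rw [Sym2.boundary_mk, he]
    exact funext fun _ => CharTwo.add_self_eq_zero _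

theorem Sym2.boundary_add_boundary (a b c : V) :
    s(a, b).boundary + s(a, c).boundary = s(b, c).boundary := by
  simp only [Sym2.boundary_mk]
  have h : (Pi.single a 1 + Pi.single a 1 : V → ZMod 2) = 0 :=
    funext fun _ => CharTwo.add_self_eq_zero _
  rw [add_add_add_comm, h, zero_add]

@[simp] theorem Multiset.boundary_zero : (0 : Multiset (Sym2 V)).boundary = 0 := rfl

@[simp] theorem Multiset.boundary_cons (e : Sym2 V) (P : Multiset (Sym2 V)) :
    (e ::ₘ P).boundary = e.boundary + P.boundary := by
  simp [Multiset.boundary]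

@[simp] theorem Multiset.boundary_add (P Q : Multiset (Sym2 V)) :
    (P + Q).boundary = P.boundary + Q.boundary := by
  simp [Multiset.boundary]

theorem Multiset.boundary_sum {ι : Type*} (s : Finset ι) (P : ι → Multiset (Sym2 V)) :
    (∑ i ∈ s, P i).boundary = ∑ i ∈ s, (P i).boundary := by
  classical
  induction s using Finset.induction_on with
  | empty => simp
  | insert i s hi ih => simp [Finset.sum_insert hi, ih]

theorem Finset.boundary_val (A : Finset (Sym2 V)) : A.val.boundary = ∑ e ∈ A, e.boundary := rfl

theorem Finset.boundary_val_apply {A : Finset (Sym2 V)} (hA : ∀ e ∈ A, ¬ e.IsDiag) (v : V) :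
    A.val.boundary v = (A.filter (v ∈ ·)).card := by
  rw [Finset.boundary_val, Finset.sum_apply, Finset.sum_congr rfl
    fun e he => Sym2.boundary_apply (hA e he) v]
  simp

/-- If the boundary of a multiset of pairs does not vanish at `v`, some pair contains `v`. -/
theorem Multiset.exists_mem_of_boundary_ne_zero {P : Multiset (Sym2 V)} {v : V}
    (h : P.boundary v ≠ 0) : ∃ e ∈ P, v ∈ e := by
  induction P using Multiset.induction_on with
  | empty => simp at h
  | cons e P ih =>
    by_cases hv : v ∈ e
    · exact ⟨e, Multiset.mem_cons_self _ _, hv⟩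
    · have he : e.boundary v = 0 := by
        by_cases hd : e.IsDiag
        · rw [Sym2.boundary_of_isDiag hd]; rfl
        · rw [Sym2.boundary_apply hd, if_neg hv]
      rw [Multiset.boundary_cons, Pi.add_apply, he, zero_add] at h
      obtain ⟨f, hf, hvf⟩ := ih h
      exact ⟨f, Multiset.mem_cons_of_mem hf, hvf⟩

theorem IsPerfectPairingOn.boundary_apply {O : Finset V} {A : Finset (Sym2 V)}
    (h : IsPerfectPairingOn O A) (v : V) :
    A.val.boundary v = if v ∈ O then 1 else 0 := by
  rw [Finset.boundary_val_apply fun e he => (h.1 e he).1]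
  split_ifs with hv
  · obtain ⟨e, ⟨he, hve⟩, huniq⟩ := h.2 v hv
    have : A.filter (v ∈ ·) = {e} := by
      ext f
      simp only [Finset.mem_filter, Finset.mem_singleton]
      exact ⟨fun hf => huniq f hf, fun hf => hf ▸ ⟨he, hve⟩⟩
    simp [this]
  · have : A.filter (v ∈ ·) = ∅ :=
      Finset.filter_eq_empty_iff.2 fun e he hve => hv ((h.1 e he).2 v hve)
    simp [this]

/-- Non-diagonal, pairwise disjoint pairs form a perfect pairing of the support of their
boundary. -/
theorem isPerfectPairingOn_of_disjoint [Fintype V] {A : Finset (Sym2 V)}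
    (hdiag : ∀ e ∈ A, ¬ e.IsDiag)
    (hdisj : ∀ e ∈ A, ∀ f ∈ A, ∀ v, v ∈ e → v ∈ f → e = f) :
    IsPerfectPairingOn (Finset.univ.filter fun v => A.val.boundary v ≠ 0) A := by
  refine ⟨fun e he => ⟨hdiag e he, fun v hv => ?_⟩, fun v hv => ?_⟩
  · have : A.filter (v ∈ ·) = {e} := by
      ext f
      simp only [Finset.mem_filter, Finset.mem_singleton]
      exact ⟨fun hf => hdisj f hf.1 e he v hf.2 hv, fun hf => hf ▸ ⟨he, hv⟩⟩
    simp [Finset.boundary_val_apply hdiag, this]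
  · obtain ⟨e, he, hve⟩ := Multiset.exists_mem_of_boundary_ne_zero (Finset.mem_filter.1 hv).2
    exact ⟨e, ⟨he, hve⟩, fun f hf => hdisj f hf.1 e he v hf.2 hve⟩

/-- For a nonnegative cost satisfying the triangle inequality, every multiset of pairs can be
replaced, without increasing the cost, by a perfect pairing of the support of its boundary. -/
theorem exists_isPerfectPairingOn_sum_le [Fintype V] {d : Sym2 V → ℝ} (hd : ∀ e, 0 ≤ d e)
    (htri : ∀ a b c, d s(b, c) ≤ d s(a, b) + d s(a, c)) (P : Multiset (Sym2 V)) :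
    ∃ A : Finset (Sym2 V),
      IsPerfectPairingOn (Finset.univ.filter fun v => P.boundary v ≠ 0) A ∧
        ∑ e ∈ A, d e ≤ (P.map d).sum := by
  by_cases hdiag : ∃ e ∈ P, e.IsDiag
  · obtain ⟨e, he, hed⟩ := hdiag
    obtain ⟨Q, rfl⟩ := Multiset.exists_cons_of_mem he
    obtain ⟨A, hA, hAd⟩ := exists_isPerfectPairingOn_sum_le hd htri Q
    refine ⟨A, by simpa [Sym2.boundary_of_isDiag hed] using hA, ?_⟩
    rw [Multiset.map_cons, Multiset.sum_cons]
    linarith [hd e]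
  by_cases hshare : ∃ (a b c : V) (Q : Multiset (Sym2 V)), P = s(a, b) ::ₘ s(a, c) ::ₘ Q
  · obtain ⟨a, b, c, Q, rfl⟩ := hshare
    obtain ⟨A, hA, hAd⟩ := exists_isPerfectPairingOn_sum_le hd htri (s(b, c) ::ₘ Q)
    refine ⟨A, ?_, ?_⟩
    · rwa [Multiset.boundary_cons, ← Sym2.boundary_add_boundary a, add_assoc,
        ← Multiset.boundary_cons, ← Multiset.boundary_cons] at hA
    · simp only [Multiset.map_cons, Multiset.sum_cons] at hAd ⊢
      linarith [htri a b c]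
  push Not at hdiag
  have hnodup : P.Nodup := by
    refine Multiset.nodup_iff_ne_cons_cons.2 fun e Q hQ => hshare ?_
    induction e with
    | h a b => exact ⟨a, b, b, Q, hQ⟩
  refine ⟨⟨P, hnodup⟩, isPerfectPairingOn_of_disjoint hdiag fun e he f hf v hve hvf => ?_, le_rfl⟩
  by_contra hne
  obtain ⟨b, rfl⟩ := hve
  obtain ⟨c, rfl⟩ := hvf
  obtain ⟨Q, hQ⟩ := Multiset.exists_cons_of_mem (show s(v, b) ∈ P from he)
  have hf' : s(v, c) ∈ P := hf
  rw [hQ, Multiset.mem_cons] at hf'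
  obtain ⟨Q', rfl⟩ := Multiset.exists_cons_of_mem (hf'.resolve_left (Ne.symm hne))
  exact hshare ⟨v, b, c, Q', hQ⟩
termination_by P.card
decreasing_by
  · subst_vars; simp
  · subst_vars; simp

end Boundary

namespace SimpleGraph

variable {V : Type*} {G : SimpleGraph V} {w : Sym2 V → ℝ}

theorem Walk.weight_append {u v x : V} (p : G.Walk u v) (q : G.Walk v x) :
    (p.append q).weight w = p.weight w + q.weight w := by
  simp [Walk.weight]

theorem Walk.weight_reverse {u v : V} (p : G.Walk u v) : p.reverse.weight w = p.weight w := by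
  simp [Walk.weight]

theorem Walk.weight_nonneg (hw : ∀ e ∈ G.edgeSet, 0 ≤ w e) {u v : V} (p : G.Walk u v) :
    0 ≤ p.weight w := by
  refine List.sum_nonneg fun x hx => ?_
  obtain ⟨e, he, rfl⟩ := List.mem_map.1 hx
  exact hw e (p.edges_subset_edgeSet he)

theorem pairDist_nonneg (hw : ∀ e ∈ G.edgeSet, 0 ≤ w e) (e : Sym2 V) : 0 ≤ pairDist G w e := by
  refine Real.sInf_nonneg ?_
  rintro r ⟨u, v, -, p, rfl⟩
  exact p.weight_nonneg hw

theorem pairDist_le_weight (hw : ∀ e ∈ G.edgeSet, 0 ≤ w e) {u v : V} (p : G.Walk u v) :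
    pairDist G w s(u, v) ≤ p.weight w := by
  refine csInf_le ⟨0, ?_⟩ ⟨u, v, rfl, p, rfl⟩
  rintro r ⟨u, v, -, p, rfl⟩
  exact p.weight_nonneg hw

theorem Connected.exists_walk_weight_lt (hG : G.Connected) (w : Sym2 V → ℝ) (u v : V) {ε : ℝ}
    (hε : 0 < ε) : ∃ p : G.Walk u v, p.weight w < pairDist G w s(u, v) + ε := by
  obtain ⟨p₀⟩ := hG.preconnected u v
  obtain ⟨r, ⟨a, b, hab, p, rfl⟩, hr⟩ := exists_lt_of_csInf_lt
    (s := {r : ℝ | ∃ a b : V, s(u, v) = s(a, b) ∧ ∃ p : G.Walk a b, r = p.weight w})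
    ⟨_, u, v, rfl, p₀, rfl⟩ (lt_add_of_pos_right (pairDist G w s(u, v)) hε)
  obtain ⟨rfl, rfl⟩ | ⟨rfl, rfl⟩ := Sym2.eq_iff.1 hab
  · exact ⟨p, hr⟩
  · exact ⟨p.reverse, by rwa [Walk.weight_reverse]⟩

theorem Connected.pairDist_triangle (hG : G.Connected) (hw : ∀ e ∈ G.edgeSet, 0 ≤ w e)
    (a b c : V) :
    pairDist G w s(b, c) ≤ pairDist G w s(a, b) + pairDist G w s(a, c) := by
  refine le_of_forall_pos_le_add fun ε hε => ?_
  obtain ⟨p, hp⟩ := hG.exists_walk_weight_lt w a b (half_pos hε)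
  obtain ⟨q, hq⟩ := hG.exists_walk_weight_lt w a c (half_pos hε)
  have h := pairDist_le_weight hw (p.reverse.append q)
  rw [Walk.weight_append, Walk.weight_reverse] at h
  linarith

theorem pairDist_le (hw : ∀ e ∈ G.edgeSet, 0 ≤ w e) {e : Sym2 V} (he : e ∈ G.edgeSet) :
    pairDist G w e ≤ w e := by
  induction e with
  | h a b =>
    simpa [Walk.weight] using pairDist_le_weight hw (Walk.cons (G.mem_edgeSet.1 he) Walk.nil)

variable [DecidableEq V]

theorem Walk.boundary_edges {u v : V} (p : G.Walk u v) :
    (p.edges : Multiset (Sym2 V)).boundary = s(u, v).boundary := by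
  induction p with
  | nil => rw [Sym2.boundary_of_isDiag (Sym2.mk_isDiag_iff.2 rfl)]; rfl
  | @cons a b c h p ih =>
    rw [Walk.edges_cons, ← Multiset.cons_coe, Multiset.boundary_cons, ih, Sym2.eq_swap,
      Sym2.boundary_add_boundary]

/-- Every edge multiset containing all edges of a connected graph and having all degrees even is
the edge multiset of a closed walk. -/
theorem Connected.exists_closed_walk_edges_eq (hG : G.Connected) {M : Multiset (Sym2 V)}
    (hM : ∀ e, e ∈ M ↔ e ∈ G.edgeSet) (hbd : M.boundary = 0) :
    ∃ (u : V) (p : G.Walk u u), (p.edges : Multiset (Sym2 V)) = M := by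
  obtain ⟨o⟩ := hG.nonempty
  let S : Set ℕ := {n | ∃ (u v : V) (p : G.Walk u v),
    (p.edges : Multiset (Sym2 V)) ≤ M ∧ p.length = n}
  have hS : BddAbove S := by
    refine ⟨M.card, ?_⟩
    rintro n ⟨u, v, p, hp, rfl⟩
    simpa using Multiset.card_le_card hp
  have hne : S.Nonempty := ⟨0, o, o, Walk.nil, by simp, rfl⟩
  obtain ⟨u, v, p, hp, hlen⟩ := Nat.sSup_mem hne hS
  have hmax : ∀ {a b : V} (q : G.Walk a b), (q.edges : Multiset (Sym2 V)) ≤ M →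
      q.length ≤ p.length := fun q hq => hlen ▸ le_csSup hS ⟨_, _, q, hq, rfl⟩
  obtain ⟨R, rfl⟩ := Multiset.le_iff_exists_add.1 hp
  have hext : ∀ {a b : V} (q : G.Walk a b), (q.edges : Multiset (Sym2 V)) = p.edges →
      ∀ e ∈ R, a ∉ e := by
    rintro a b q hq e he ⟨c, rfl⟩
    have hadj : G.Adj c a := by
      rw [← G.mem_edgeSet, Sym2.eq_swap]
      exact (hM _).1 (Multiset.mem_add.2 (Or.inr he))
    have hle : ((Walk.cons hadj q).edges : Multiset (Sym2 V)) ≤ p.edges + R := by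
      rw [Walk.edges_cons, ← Multiset.cons_coe, hq, Sym2.eq_swap, ← Multiset.singleton_add,
        add_comm]
      exact add_le_add_right (Multiset.singleton_le.2 he) _
    have h₁ := hmax _ hle
    have h₂ : q.length = p.length := by
      simpa using congrArg Multiset.card hq
    rw [Walk.length_cons] at h₁
    omega
  have hclosed : u = v := by
    by_contra huv
    rw [Multiset.boundary_add, Walk.boundary_edges] at hbd
    have h := congrFun hbd u
    rw [Pi.add_apply, Sym2.boundary_apply (by simpa using huv), if_pos (Sym2.mem_mk_left u v)] at h
    obtain ⟨e, he, hue⟩ := Multiset.exists_mem_of_boundary_ne_zero (P := R) (v := u)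
      (fun h0 => by rw [h0] at h; exact one_ne_zero h)
    exact hext p rfl e he hue
  subst hclosed
  have hsupp : ∀ x ∈ p.support, ∀ e ∈ R, x ∉ e := fun x hx =>
    hext (p.rotate x hx) (Multiset.coe_eq_coe.2 (p.rotate_edges x hx).perm)
  refine ⟨u, p, ?_⟩
  suffices R = 0 by simp [this]
  refine Multiset.eq_zero_of_forall_notMem fun e he => ?_
  induction e with
  | h a b =>
    have ha : a ∉ p.support := fun h => hsupp a h _ he (Sym2.mem_mk_left a b)
    obtain ⟨q⟩ := hG.preconnected u a
    obtain ⟨d, -, hd₁, hd₂⟩ := q.exists_boundary_dart {x | x ∈ p.support} p.start_mem_support ha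
    have hdM := (hM d.edge).2 d.edge_mem
    rcases Multiset.mem_add.1 hdM with h | h
    · exact hd₂ (p.snd_mem_support_of_mem_edges (Multiset.mem_coe.1 h))
    · exact hsupp _ hd₁ _ h (Sym2.mem_mk_left _ _)

variable [Fintype V] [DecidableRel G.Adj]

theorem boundary_edgeFinset_apply (v : V) : G.edgeFinset.val.boundary v = G.degree v := by
  rw [Finset.boundary_val_apply fun e he => G.not_isDiag_of_mem_edgeSet (mem_edgeFinset.1 he),
    ← G.card_incidenceFinset_eq_degree, G.incidenceFinset_eq_filter]

theorem mem_oddDegreeVertices_iff {v : V} :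
    v ∈ G.oddDegreeVertices ↔ G.edgeFinset.val.boundary v ≠ 0 := by
  simp [oddDegreeVertices, boundary_edgeFinset_apply, ZMod.natCast_ne_zero_iff_odd]

/-- A closed walk through every edge yields a perfect pairing of the odd-degree vertices whose
cost is at most the weight of the repeated edges. -/
theorem Connected.exists_isPerfectPairingOn_le_weight (hG : G.Connected)
    (hw : ∀ e ∈ G.edgeSet, 0 ≤ w e) {u : V} (p : G.Walk u u)
    (hp : ∀ e ∈ G.edgeSet, e ∈ p.edges) :
    ∃ A, IsPerfectPairingOn G.oddDegreeVertices A ∧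
      ∑ e ∈ G.edgeFinset, w e + ∑ e ∈ A, pairDist G w e ≤ p.weight w := by
  obtain ⟨R, hR⟩ : ∃ R, (p.edges : Multiset (Sym2 V)) = G.edgeFinset.val + R :=
    Multiset.le_iff_exists_add.1 <| (Multiset.le_iff_subset G.edgeFinset.nodup).2
      fun e he => hp e (mem_edgeFinset.1 he)
  have hbd : R.boundary = G.edgeFinset.val.boundary := by
    have h := p.boundary_edges
    rw [Sym2.boundary_of_isDiag (Sym2.mk_isDiag_iff.2 rfl), hR, Multiset.boundary_add] at h
    exact funext fun v => (CharTwo.add_eq_zero.1 (congrFun h v)).symm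
  obtain ⟨A, hA, hle⟩ := exists_isPerfectPairingOn_sum_le (pairDist_nonneg hw)
    (hG.pairDist_triangle hw) R
  refine ⟨A, ?_, ?_⟩
  · convert hA
    ext v
    simp [mem_oddDegreeVertices_iff, hbd]
  · have hweight : p.weight w = ∑ e ∈ G.edgeFinset, w e + (R.map w).sum := by
      rw [Walk.weight, ← Multiset.sum_coe, ← Multiset.map_coe, hR, Multiset.map_add,
        Multiset.sum_add]
      rfl
    have hRw : (R.map (pairDist G w)).sum ≤ (R.map w).sum := by
      refine Multiset.sum_map_le_sum_map _ _ fun e he => pairDist_le hw ?_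
      refine p.edges_subset_edgeSet (Multiset.mem_coe.1 ?_)
      rw [hR]
      exact Multiset.mem_add.2 (Or.inr he)
    linarith

/-- A perfect pairing of the odd-degree vertices yields closed walks through every edge of weight
arbitrarily close to the total edge weight plus the cost of the pairing. -/
theorem Connected.exists_closed_walk_weight_le (hG : G.Connected) (w : Sym2 V → ℝ)
    {A : Finset (Sym2 V)} (hA : IsPerfectPairingOn G.oddDegreeVertices A) {ε : ℝ} (hε : 0 < ε) :
    ∃ (u : V) (p : G.Walk u u), (∀ e ∈ G.edgeSet, e ∈ p.edges) ∧
      p.weight w ≤ ∑ e ∈ G.edgeFinset, w e + ∑ e ∈ A, pairDist G w e + ε := by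
  have hδ : 0 < ε / (A.card + 1) := by positivity
  have hex : ∀ e : Sym2 V, ∃ L : Multiset (Sym2 V), (∀ f ∈ L, f ∈ G.edgeSet) ∧
      L.boundary = e.boundary ∧ (L.map w).sum ≤ pairDist G w e + ε / (A.card + 1) := by
    intro e
    induction e with
    | h a b =>
      obtain ⟨p, hp⟩ := hG.exists_walk_weight_lt w a b hδ
      exact ⟨p.edges, fun f hf => p.edges_subset_edgeSet hf, p.boundary_edges,
        by simpa [Walk.weight] using hp.le⟩
  choose L hLG hLbd hLw using hex
  have hbd : (G.edgeFinset.val + ∑ e ∈ A, L e).boundary = 0 := by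
    have hsum : (∑ e ∈ A, L e).boundary = A.val.boundary := by
      rw [Multiset.boundary_sum, Finset.boundary_val]
      exact Finset.sum_congr rfl fun e _ => hLbd e
    have hAE : A.val.boundary = G.edgeFinset.val.boundary := by
      ext1 v
      rw [hA.boundary_apply]
      split_ifs with hv
      · exact (Fin.eq_one_of_ne_zero _ (mem_oddDegreeVertices_iff.1 hv)).symm
      · exact (not_not.1 (mem_oddDegreeVertices_iff.not.1 hv)).symm
    rw [Multiset.boundary_add, hsum, hAE]
    exact funext fun _ => CharTwo.add_self_eq_zero _
  have hmem : ∀ e, e ∈ G.edgeFinset.val + ∑ e ∈ A, L e ↔ e ∈ G.edgeSet := by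
    intro e
    rw [Multiset.mem_add, Finset.mem_val, mem_edgeFinset, Multiset.mem_sum]
    exact ⟨fun h => h.elim id fun ⟨f, _, hf⟩ => hLG f e hf, Or.inl⟩
  obtain ⟨u, p, hp⟩ := hG.exists_closed_walk_edges_eq hmem hbd
  refine ⟨u, p, fun e he => Multiset.mem_coe.1 (hp ▸ (hmem e).2 he), ?_⟩
  have hweight : p.weight w = ∑ e ∈ G.edgeFinset, w e + ∑ e ∈ A, ((L e).map w).sum := by
    rw [Walk.weight, ← Multiset.sum_coe, ← Multiset.map_coe, hp, Multiset.map_add,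
      Multiset.sum_add, ← Multiset.coe_mapAddMonoidHom, map_sum, ← Multiset.coe_sumAddMonoidHom,
      map_sum]
    rfl
  have hcost : ∑ e ∈ A, ((L e).map w).sum ≤
      ∑ e ∈ A, pairDist G w e + A.card * (ε / (A.card + 1)) := by
    refine (Finset.sum_le_sum fun e _ => hLw e).trans_eq ?_
    rw [Finset.sum_add_distrib, Finset.sum_const, nsmul_eq_mul]
  have hcard : A.card * (ε / (A.card + 1)) ≤ ε := by
    rw [mul_div_assoc', div_le_iff₀ (by positivity)]
    nlinarith
  linarith

end SimpleGraph

/-- Let `G` be a finite connected simple graph on a nonempty vertex set with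
nonnegative edge weights `w`, and let `O` be its set of odd-degree vertices.
The infimum, over all closed walks `p` in `G` whose edge list contains every
edge of `G`, of the walk weight of `p` equals
`∑ e ∈ E(G), w e + min_A ∑ {u,v} ∈ A, dist_w u v`, the minimum being over all
perfect pairings `A` of `O`.  Hence the Closed Undirected Chinese Postman
Problem on `G` reduces to finding a minimum-weight perfect pairing of the
odd-degree vertices with respect to shortest-path distances. -/
theorem postman_problem_eq_min_perfect_pairing
    {V : Type*} [Fintype V] [DecidableEq V] [Nonempty V]
    (G : SimpleGraph V) [DecidableRel G.Adj] (hG : G.Connected)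
    (w : Sym2 V → ℝ) (hw : ∀ e ∈ G.edgeSet, 0 ≤ w e) :
    sInf {r : ℝ | ∃ (u : V) (p : G.Walk u u),
        (∀ e ∈ G.edgeSet, e ∈ p.edges) ∧ r = SimpleGraph.Walk.weight w p} =
      ∑ e ∈ G.edgeFinset, w e +
        sInf {r : ℝ | ∃ A : Finset (Sym2 V),
          IsPerfectPairingOn G.oddDegreeVertices A ∧
            r = ∑ e ∈ A, pairDist G w e} := by
  have hbdd : BddBelow {r : ℝ | ∃ A : Finset (Sym2 V),
      IsPerfectPairingOn G.oddDegreeVertices A ∧ r = ∑ e ∈ A, pairDist G w e} := by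
    refine ⟨0, ?_⟩
    rintro r ⟨A, -, rfl⟩
    exact Finset.sum_nonneg fun e _ => SimpleGraph.pairDist_nonneg hw e
  obtain ⟨A₀, hA₀, -⟩ := exists_isPerfectPairingOn_sum_le (SimpleGraph.pairDist_nonneg hw)
    (hG.pairDist_triangle hw) G.edgeFinset.val
  have hA₀' : IsPerfectPairingOn G.oddDegreeVertices A₀ := by
    convert hA₀
    ext v
    simp [SimpleGraph.mem_oddDegreeVertices_iff]
  apply le_antisymm
  · rw [← sub_le_iff_le_add']
    refine le_csInf ⟨_, A₀, hA₀', rfl⟩ ?_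
    rintro r ⟨A, hA, rfl⟩
    rw [sub_le_iff_le_add']
    refine le_of_forall_pos_le_add fun ε hε => ?_
    obtain ⟨u, p, hp, hle⟩ := hG.exists_closed_walk_weight_le w hA hε
    refine le_trans (csInf_le ⟨0, ?_⟩ ⟨u, p, hp, rfl⟩) hle
    rintro r ⟨u, p, -, rfl⟩
    exact p.weight_nonneg hw
  · obtain ⟨u₀, p₀, hp₀, -⟩ := hG.exists_closed_walk_weight_le w hA₀' one_pos
    refine le_csInf ⟨_, u₀, p₀, hp₀, rfl⟩ ?_
    rintro r ⟨u, p, hp, rfl⟩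
    obtain ⟨A, hA, hle⟩ := hG.exists_isPerfectPairingOn_le_weight hw p hp
    exact (add_le_add_right (csInf_le hbdd ⟨A, hA, rfl⟩) _).trans hle
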